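/- Let (W_•, F^•, F̄^•) be a mixed Hodge structure on a finite-dimensional complex vector space V, and define R(W_{−2}) = ( Σ_{k≥1} (F^{−k} ∩ W_{−k−1}) ) ∩ ( Σ_{k≥1} (F̄^{−k} ∩ W_{−k−1}) ). Then one has the direct sum decomposition W_{−1} = (F⁰ ∩ W_{−1}) ⊕ (F̄⁰ ∩ W_{−1}) ⊕ R(W_{−2}). Moreover, in terms of the Deligne subspaces, R(W_{−2}) = ⊕_{i≤−1, j≤−1} I^{i,j}, and the same subspace is obtained from the Deligne subspaces Ī^{i,j} defined with the roles of F and F̄ interchanged: R(W_{−2}) = ⊕_{i≤−1, j≤−1} Ī^{i,j}. -/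

import Mathlib

/-!
In a mixed Hodge structure, setting
`R(W_{−2}) = (Σ_{k≥1} (F^{−k} ∩ W_{−k−1})) ∩ (Σ_{k≥1} (F̄^{−k} ∩ W_{−k−1}))`,
one has the direct sum decomposition `W_{−1} = (F⁰ ∩ W_{−1}) ⊕ (F̄⁰ ∩ W_{−1}) ⊕ R(W_{−2})`,
and `R(W_{−2}) = ⊕_{i,j ≤ −1} I^{i,j} = ⊕_{i,j ≤ −1} Ī^{i,j}` in terms of the Deligne
subspaces (with either order of the two filtrations).
-/

/-- The image of `A ∩ W n` in the quotient `V ⧸ W (n−1)`. -/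
def grPiece {V : Type*} [AddCommGroup V] [Module ℂ V]
    (W : ℤ → Submodule ℂ V) (n : ℤ) (A : Submodule ℂ V) :
    Submodule ℂ (V ⧸ W (n - 1)) :=
  Submodule.map (W (n - 1)).mkQ (A ⊓ W n)

/-- `(W, F, F̄)` is a mixed Hodge structure on `V`. -/
def IsMHS {V : Type*} [AddCommGroup V] [Module ℂ V]
    (W F Fb : ℤ → Submodule ℂ V) : Prop :=
  Monotone W ∧ Antitone F ∧ Antitone Fb ∧
  (∃ a : ℤ, W a = ⊥) ∧ (∃ b : ℤ, W b = ⊤) ∧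
  ∀ n : ℤ,
    (Submodule.map (W (n - 1)).mkQ (W n) =
      ⨆ p : ℤ, grPiece W n (F p) ⊓ grPiece W n (Fb (n - p))) ∧
    iSupIndep (fun p : ℤ => grPiece W n (F p) ⊓ grPiece W n (Fb (n - p)))

/-- Deligne's subspace
`I^{i,j} = F^i ∩ W_{i+j} ∩ (F̄^j ∩ W_{i+j} + Σ_{k≥1} (F̄^{j−k} ∩ W_{i+j−k−1}))`. -/
def deligneI {V : Type*} [AddCommGroup V] [Module ℂ V]
    (W F Fb : ℤ → Submodule ℂ V) (i j : ℤ) : Submodule ℂ V :=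
  F i ⊓ W (i + j) ⊓
    ((Fb j ⊓ W (i + j)) ⊔ ⨆ k : ℕ, Fb (j - (k : ℤ) - 1) ⊓ W (i + j - (k : ℤ) - 2))

/-- The subspace `R(W_{−2}) = (Σ_{k≥1} (F^{−k} ∩ W_{−k−1})) ∩ (Σ_{k≥1} (F̄^{−k} ∩ W_{−k−1}))`. -/
def RW2 {V : Type*} [AddCommGroup V] [Module ℂ V]
    (W F Fb : ℤ → Submodule ℂ V) : Submodule ℂ V :=
  (⨆ k : ℕ, F (-(k : ℤ) - 1) ⊓ W (-(k : ℤ) - 2)) ⊓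
    (⨆ k : ℕ, Fb (-(k : ℤ) - 1) ⊓ W (-(k : ℤ) - 2))

section DeligneSplitting

variable {V : Type*} [AddCommGroup V] [Module ℂ V] {W F Fb : ℤ → Submodule ℂ V}

theorem grPiece_mono (W : ℤ → Submodule ℂ V) (n : ℤ) {A B : Submodule ℂ V} (h : A ≤ B) :
    grPiece W n A ≤ grPiece W n B :=
  Submodule.map_mono (inf_le_inf_right _ h)

/-- Downward induction along a family of submodules that vanishes far to the left. -/
theorem le_of_forall_le_sup_pred {G : ℤ → Submodule ℂ V} {S : Submodule ℂ V} {a : ℤ}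
    (hG : ∀ n ≤ a, G n = ⊥) {N : ℤ} (h : ∀ n ≤ N, G n ≤ S ⊔ G (n - 1)) : G N ≤ S := by
  suffices H : ∀ d : ℕ, ∀ n ≤ N, n ≤ a + d → G n ≤ S from
    H (N - a).toNat N le_rfl (by omega)
  intro d
  induction d with
  | zero => intro n _ hn; simp [hG n (by simpa using hn)]
  | succ d ih =>
    intro n hN hn
    exact (h n hN).trans (sup_le le_rfl (ih (n - 1) (by omega) (by push_cast at hn; omega)))

namespace IsMHS

theorem symm (h : IsMHS W F Fb) : IsMHS W Fb F := by
  obtain ⟨hW, hF, hFb, ha, hb, hgr⟩ := h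
  refine ⟨hW, hFb, hF, ha, hb, fun n => ?_⟩
  have key : (fun p : ℤ => grPiece W n (Fb p) ⊓ grPiece W n (F (n - p))) =
      (fun p : ℤ => grPiece W n (F p) ⊓ grPiece W n (Fb (n - p))) ∘ Equiv.subLeft n := by
    funext p
    simp [inf_comm]
  rw [key]
  refine ⟨?_, (hgr n).2.comp (Equiv.subLeft n).injective⟩
  rw [(hgr n).1]
  exact ((Equiv.subLeft n).iSup_comp
    (g := fun p : ℤ => grPiece W n (F p) ⊓ grPiece W n (Fb (n - p)))).symm

/-- The two filtrations induced on `gr_n` are `n`-opposed: trivial intersection. -/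
theorem disjoint_grPiece (h : IsMHS W F Fb) (n p : ℤ) :
    Disjoint (grPiece W n (F p)) (grPiece W n (Fb (n + 1 - p))) := by
  obtain ⟨-, hF, hFb, -, -, hgr⟩ := h
  have hdis := (hgr n).2.pairwiseDisjoint (show p ≠ p - 1 by omega)
  rw [disjoint_iff_inf_le]
  refine (le_inf ?_ ?_).trans hdis.le_bot
  · exact inf_le_inf le_rfl (grPiece_mono W n (hFb (by omega)))
  · exact inf_le_inf (grPiece_mono W n (hF (by omega))) (grPiece_mono W n (hFb (by omega)))

theorem map_mkQ_le_sup (h : IsMHS W F Fb) (n p : ℤ) :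
    Submodule.map (W (n - 1)).mkQ (W n) ≤
      (⨆ i : ℤ, ⨆ _ : p ≤ i, grPiece W n (F i) ⊓ grPiece W n (Fb (n - i))) ⊔
        grPiece W n (Fb (n + 1 - p)) := by
  obtain ⟨-, -, hFb, -, -, hgr⟩ := h
  rw [(hgr n).1]
  refine iSup_le fun i => ?_
  rcases le_or_gt p i with hi | hi
  · exact le_sup_of_le_left (le_iSup₂_of_le i hi le_rfl)
  · exact le_sup_of_le_right (inf_le_right.trans (grPiece_mono W n (hFb (by omega))))

theorem grPiece_le_iSup (h : IsMHS W F Fb) (n p : ℤ) :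
    grPiece W n (F p) ≤
      ⨆ i : ℤ, ⨆ _ : p ≤ i, grPiece W n (F i) ⊓ grPiece W n (Fb (n - i)) := by
  have hle : (⨆ i : ℤ, ⨆ _ : p ≤ i, grPiece W n (F i) ⊓ grPiece W n (Fb (n - i))) ≤
      grPiece W n (F p) :=
    iSup₂_le fun i hi => inf_le_left.trans (grPiece_mono W n (h.2.1 hi))
  have htop : grPiece W n (F p) ≤ _ :=
    (Submodule.map_mono inf_le_right).trans (h.map_mkQ_le_sup n p)
  have := le_inf htop le_rfl
  rwa [sup_inf_assoc_of_le _ hle, (h.disjoint_grPiece n p).symm.eq_bot, sup_bot_eq] at this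

theorem inf_inf_sup_le (h : IsMHS W F Fb) (n p : ℤ) :
    F p ⊓ W n ⊓ (Fb (n + 1 - p) ⊔ W (n - 1)) ≤ W (n - 1) := by
  rintro x ⟨⟨hxF, hxW⟩, hx⟩
  obtain ⟨y, hy, w, hw, rfl⟩ := Submodule.mem_sup.1 hx
  have hyW : y ∈ W n := by
    simpa using sub_mem hxW (h.1 (show n - 1 ≤ n by omega) hw)
  have heq : (W (n - 1)).mkQ (y + w) = (W (n - 1)).mkQ y := by
    simpa using hw
  have := Submodule.disjoint_def.1 (h.disjoint_grPiece n p) _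
    (Submodule.mem_map_of_mem ⟨hxF, hxW⟩) (heq ▸ Submodule.mem_map_of_mem ⟨hy, hyW⟩)
  rwa [← LinearMap.mem_ker, Submodule.ker_mkQ] at this

theorem le_sup_sup (h : IsMHS W F Fb) (n p : ℤ) :
    W n ≤ F p ⊓ W n ⊔ Fb (n + 1 - p) ⊓ W n ⊔ W (n - 1) := by
  have h1 : Submodule.map (W (n - 1)).mkQ (W n) ≤
      Submodule.map (W (n - 1)).mkQ (F p ⊓ W n ⊔ Fb (n + 1 - p) ⊓ W n) := by
    rw [Submodule.map_sup]
    refine (h.map_mkQ_le_sup n p).trans (sup_le_sup_right ?_ _)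
    exact iSup₂_le fun i hi => inf_le_left.trans (grPiece_mono W n (h.2.1 hi))
  have h2 := Submodule.map_le_iff_le_comap.1 h1
  rwa [Submodule.comap_map_mkQ, sup_comm] at h2

end IsMHS

/-- The correction term `Σ_{k≥1} (G^{m−k} ∩ W_{n−k−1})` of Deligne's formula. -/
def deligneTail (W G : ℤ → Submodule ℂ V) (m n : ℤ) : Submodule ℂ V :=
  ⨆ k : ℕ, G (m - (k : ℤ) - 1) ⊓ W (n - (k : ℤ) - 2)

theorem RW2_eq (W F Fb : ℤ → Submodule ℂ V) :
    RW2 W F Fb = deligneTail W F 0 0 ⊓ deligneTail W Fb 0 0 := by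
  simp [RW2, deligneTail]

theorem RW2_comm (W F Fb : ℤ → Submodule ℂ V) : RW2 W F Fb = RW2 W Fb F :=
  inf_comm _ _

theorem le_deligneTail (W G : ℤ → Submodule ℂ V) (hW : Monotone W) (hG : Antitone G)
    {m n l l' : ℤ} (hl : l ≤ m - 1) (hl' : l' ≤ n - m + l - 1) :
    G l ⊓ W l' ≤ deligneTail W G m n :=
  le_iSup_of_le (m - 1 - l).toNat (inf_le_inf (hG (by omega)) (hW (by omega)))

namespace IsMHS

theorem eq_bot_of_le (h : IsMHS W F Fb) : ∃ a, ∀ n ≤ a, W n = ⊥ := by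
  obtain ⟨a, ha⟩ := h.2.2.2.1
  exact ⟨a, fun n hn => le_bot_iff.1 (ha ▸ h.1 hn)⟩

theorem le_sup_deligneTail (h : IsMHS W F Fb) (i j : ℤ) :
    W (i + j - 1) ≤
      F i ⊓ W (i + j - 1) ⊔ (Fb j ⊓ W (i + j - 1) ⊔ deligneTail W Fb j (i + j)) := by
  obtain ⟨a, ha⟩ := h.eq_bot_of_le
  refine le_of_forall_le_sup_pred ha fun n hn => ?_
  refine (h.le_sup_sup n i).trans (sup_le_sup_right (sup_le_sup ?_ ?_) _)
  · exact inf_le_inf_left _ (h.1 hn)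
  · rcases hn.eq_or_lt with rfl | hn
    · exact le_sup_of_le_left (inf_le_inf_right _ (h.2.2.1 (by omega)))
    · exact le_sup_of_le_right
        (le_deligneTail W Fb h.1 h.2.2.1 (by omega) (by omega))

theorem disjoint_sup_deligneTail (h : IsMHS W F Fb) (i j : ℤ) :
    Disjoint (F i ⊓ W (i + j - 1)) (Fb j ⊓ W (i + j - 1) ⊔ deligneTail W Fb j (i + j)) := by
  obtain ⟨a, ha⟩ := h.eq_bot_of_le
  set C := Fb j ⊓ W (i + j - 1) ⊔ deligneTail W Fb j (i + j)
  have hCle : ∀ n ≤ i + j - 1, C ≤ Fb (n + 1 - i) ⊔ W (n - 1) := by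
    intro n hn
    refine sup_le (le_sup_of_le_left (inf_le_left.trans (h.2.2.1 (by omega)))) ?_
    refine iSup_le fun k => ?_
    rcases le_or_gt (n + 1 - i) (j - k - 1) with hk | hk
    · exact le_sup_of_le_left (inf_le_left.trans (h.2.2.1 hk))
    · exact le_sup_of_le_right (inf_le_right.trans (h.1 (by omega)))
  have key := le_of_forall_le_sup_pred (G := fun n => F i ⊓ W n ⊓ C) (S := ⊥) (a := a)
    (N := i + j - 1) (fun n hn => by simp [ha n hn]) fun n hn => by
      rw [bot_sup_eq]
      exact le_inf (le_inf (inf_le_left.trans inf_le_left)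
        ((inf_le_inf_left _ (hCle n hn)).trans (h.inf_inf_sup_le n i))) inf_le_right
  exact disjoint_iff_inf_le.2 key

/-- Every class of type `(i, j)` in `gr_{i+j}` lifts to Deligne's subspace. -/
theorem grPiece_inf_le_map_deligneI (h : IsMHS W F Fb) (n i : ℤ) :
    grPiece W n (F i) ⊓ grPiece W n (Fb (n - i)) ≤
      Submodule.map (W (n - 1)).mkQ (deligneI W F Fb i (n - i)) := by
  rintro _ ⟨⟨x, ⟨hxF, hxW⟩, rfl⟩, y, ⟨hyF, hyW⟩, hxy⟩
  have hw : x - y ∈ W (n - 1) := by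
    rw [← Submodule.Quotient.eq]
    exact hxy.symm
  have hn : i + (n - i) = n := by omega
  have hspan := h.le_sup_deligneTail i (n - i)
  rw [hn] at hspan
  obtain ⟨f, ⟨hfF, hfW⟩, c, hc, hfc⟩ := Submodule.mem_sup.1 (hspan hw)
  have hWle : W (n - 1) ≤ W n := h.1 (by omega)
  refine ⟨x - f, ?_, ?_⟩
  · rw [deligneI, hn]
    refine ⟨⟨sub_mem hxF hfF, sub_mem hxW (hWle hfW)⟩, ?_⟩
    have hxf : x - f = y + c := by
      rw [sub_eq_iff_eq_add, add_assoc, add_comm c f, hfc]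
      abel
    rw [hxf]
    exact add_mem (Submodule.mem_sup_left ⟨hyF, hyW⟩)
      (sup_le_sup_right (inf_le_inf_left _ hWle) _ hc)
  · simpa using hfW

/-- Deligne's subspaces split both filtrations: the part of `F^p ∩ W_n`. -/
theorem inf_le_iSup_deligneI (h : IsMHS W F Fb) (p N : ℤ) :
    F p ⊓ W N ≤
      ⨆ i : ℤ, ⨆ _ : p ≤ i, ⨆ j : ℤ, ⨆ _ : i + j ≤ N, deligneI W F Fb i j := by
  obtain ⟨a, ha⟩ := h.eq_bot_of_le
  refine le_of_forall_le_sup_pred (G := fun n => F p ⊓ W n) (a := a)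
    (fun n hn => by simp [ha n hn]) fun n hn => ?_
  set D := ⨆ i : ℤ, ⨆ _ : p ≤ i, deligneI W F Fb i (n - i)
  have hDF : D ≤ F p :=
    iSup₂_le fun i hi => (inf_le_left.trans inf_le_left).trans (h.2.1 hi)
  have hDW : D ≤ W n :=
    iSup₂_le fun i hi => (inf_le_left.trans inf_le_right).trans (h.1 (by omega))
  have hmap : Submodule.map (W (n - 1)).mkQ (F p ⊓ W n) ≤ Submodule.map (W (n - 1)).mkQ D :=
    (h.grPiece_le_iSup n p).trans <| iSup₂_le fun i hi =>
      (h.grPiece_inf_le_map_deligneI n i).trans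
        (Submodule.map_mono (le_iSup₂_of_le (f := fun i (_ : p ≤ i) => deligneI W F Fb i (n - i))
          i hi le_rfl))
  have hle := Submodule.map_le_iff_le_comap.1 hmap
  rw [Submodule.comap_map_mkQ, sup_comm] at hle
  calc F p ⊓ W n ≤ (D ⊔ W (n - 1)) ⊓ F p := le_inf hle inf_le_left
    _ = D ⊔ W (n - 1) ⊓ F p := sup_inf_assoc_of_le _ hDF
    _ ≤ _ := by
      rw [inf_comm]
      refine sup_le_sup_right ?_ _
      exact iSup₂_le fun i hi => le_iSup₂_of_le i hi
        (le_iSup₂_of_le (n - i) (by omega) le_rfl)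

theorem deligneI_le_RW2 (h : IsMHS W F Fb) {i j : ℤ} (hi : i ≤ -1) (hj : j ≤ -1) :
    deligneI W F Fb i j ≤ RW2 W F Fb := by
  rw [RW2_eq]
  refine le_inf (inf_le_left.trans ?_) (inf_le_right.trans (sup_le ?_ (iSup_le fun k => ?_)))
  · exact le_deligneTail W F h.1 h.2.1 (by omega) (by omega)
  · exact le_deligneTail W Fb h.1 h.2.2.1 (by omega) (by omega)
  · exact le_deligneTail W Fb h.1 h.2.2.1 (by omega) (by omega)

theorem deligneTail_le (h : IsMHS W F Fb) :
    deligneTail W F 0 0 ≤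
      (⨆ i : ℤ, ⨆ (_ : i ≤ -1), ⨆ j : ℤ, ⨆ (_ : j ≤ -1), deligneI W F Fb i j) ⊔
        F 0 ⊓ W (-1) := by
  refine iSup_le fun k => (h.inf_le_iSup_deligneI _ _).trans ?_
  refine iSup₂_le fun i hi => iSup₂_le fun j hj => ?_
  rcases le_or_gt i (-1) with hi' | hi'
  · exact le_sup_of_le_left (le_iSup₂_of_le i hi' (le_iSup₂_of_le j (by omega) le_rfl))
  · exact le_sup_of_le_right
      (inf_le_left.trans (inf_le_inf (h.2.1 (by omega)) (h.1 (by omega))))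

theorem disjoint_sup_RW2 (h : IsMHS W F Fb) :
    Disjoint (F 0 ⊓ W (-1)) ((Fb 0 ⊓ W (-1)) ⊔ RW2 W F Fb) := by
  have := h.disjoint_sup_deligneTail 0 0
  rw [RW2_eq]
  exact this.mono_right (sup_le_sup_left inf_le_right _)

theorem RW2_eq_iSup_deligneI (h : IsMHS W F Fb) :
    RW2 W F Fb =
      ⨆ i : ℤ, ⨆ (_ : i ≤ -1), ⨆ j : ℤ, ⨆ (_ : j ≤ -1), deligneI W F Fb i j := by
  have hle : (⨆ i : ℤ, ⨆ (_ : i ≤ -1), ⨆ j : ℤ, ⨆ (_ : j ≤ -1), deligneI W F Fb i j) ≤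
      RW2 W F Fb :=
    iSup₂_le fun i hi => iSup₂_le fun j hj => h.deligneI_le_RW2 hi hj
  refine le_antisymm ?_ hle
  have hdis : F 0 ⊓ W (-1) ⊓ RW2 W F Fb = ⊥ :=
    (h.disjoint_sup_RW2.mono_right le_sup_right).eq_bot
  have hR : RW2 W F Fb ≤ deligneTail W F 0 0 := by
    rw [RW2_eq]
    exact inf_le_left
  have := le_inf (hR.trans h.deligneTail_le) le_rfl
  rwa [sup_inf_assoc_of_le _ hle, hdis, sup_bot_eq] at this

theorem RW2_le (h : IsMHS W F Fb) : RW2 W F Fb ≤ W (-1) :=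
  inf_le_left.trans (iSup_le fun _ => inf_le_right.trans (h.1 (by omega)))

end IsMHS

end DeligneSplitting

theorem decomposition_of_Wminus1
    {V : Type*} [AddCommGroup V] [Module ℂ V] [FiniteDimensional ℂ V]
    (W F Fb : ℤ → Submodule ℂ V) (hMHS : IsMHS W F Fb) :
    -- `W_{−1} = (F⁰ ∩ W_{−1}) ⊕ (F̄⁰ ∩ W_{−1}) ⊕ R(W_{−2})`
    W (-1) = (F 0 ⊓ W (-1)) ⊔ (Fb 0 ⊓ W (-1)) ⊔ RW2 W F Fb ∧
    Disjoint (F 0 ⊓ W (-1)) ((Fb 0 ⊓ W (-1)) ⊔ RW2 W F Fb) ∧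
    Disjoint (Fb 0 ⊓ W (-1)) ((F 0 ⊓ W (-1)) ⊔ RW2 W F Fb) ∧
    Disjoint (RW2 W F Fb) ((F 0 ⊓ W (-1)) ⊔ (Fb 0 ⊓ W (-1))) ∧
    -- `R(W_{−2}) = ⊕_{i,j ≤ −1} I^{i,j}`
    RW2 W F Fb =
      (⨆ i : ℤ, ⨆ (_ : i ≤ -1), ⨆ j : ℤ, ⨆ (_ : j ≤ -1), deligneI W F Fb i j) ∧
    -- `R(W_{−2}) = ⊕_{i,j ≤ −1} Ī^{i,j}`, with the roles of `F` and `F̄` interchanged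
    RW2 W F Fb =
      (⨆ i : ℤ, ⨆ (_ : i ≤ -1), ⨆ j : ℤ, ⨆ (_ : j ≤ -1), deligneI W Fb F j i) := by
  have hdis := hMHS.disjoint_sup_RW2
  have hdis' := hMHS.symm.disjoint_sup_RW2
  rw [RW2_comm W Fb F] at hdis'
  refine ⟨le_antisymm ?_ (sup_le (sup_le inf_le_right inf_le_right) hMHS.RW2_le),
    hdis, hdis', ?_, hMHS.RW2_eq_iSup_deligneI, ?_⟩
  · refine (hMHS.symm.le_sup_deligneTail 0 0).trans (sup_le ?_ (sup_le ?_ ?_))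
    · exact le_sup_of_le_left le_sup_right
    · exact le_sup_of_le_left le_sup_left
    · refine hMHS.deligneTail_le.trans ?_
      rw [← hMHS.RW2_eq_iSup_deligneI]
      exact sup_le le_sup_right (le_sup_of_le_left le_sup_left)
  · rw [Submodule.disjoint_def]
    intro x hx hfg
    obtain ⟨f, hf, g, hg, rfl⟩ := Submodule.mem_sup.1 hfg
    have hf0 : f = 0 := Submodule.disjoint_def.1 hdis f hf (by
      simpa using sub_mem (Submodule.mem_sup_right hx) (Submodule.mem_sup_left hg))
    have hg0 : g = 0 := Submodule.disjoint_def.1 hdis' g hg (by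
      simpa using sub_mem (Submodule.mem_sup_right hx) (Submodule.mem_sup_left hf))
    rw [hf0, hg0, add_zero]
  · rw [RW2_comm, hMHS.symm.RW2_eq_iSup_deligneI]
    refine le_antisymm ?_ ?_
    · exact iSup₂_le fun j hj => iSup₂_le fun i hi =>
        le_iSup₂_of_le i hi (le_iSup₂_of_le j hj le_rfl)
    · exact iSup₂_le fun i hi => iSup₂_le fun j hj =>
        le_iSup₂_of_le j hj (le_iSup₂_of_le i hi le_rfl)
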